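/- Suppose all existentially closed models of T₀ have the same existential theory. Let p(x) be a complete parameter-free L₀-type that is not e-isolated, and let b be a finite tuple in N. Then the set X_b of expansions σ ∈ Y with (N,σ) ⊨ ¬p↾1(b), i.e. such that b does not realize p↾1(x) in (N,σ), is open and dense in Y. -/

import Mathlib

open FirstOrder FirstOrder.Language

namespace GenExp

/-- The type of expansions of the `L`-structure `N` to the language `L.sum L'`:
an expansion is an interpretation of the new symbols, i.e. an `L'`-structure on `N`. -/
def Expansions (L L' : FirstOrder.Language.{0,0}) (N : Type) [L.Structure N] : Type :=
  L'.Structure N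

variable {L L' : FirstOrder.Language.{0,0}} {N : Type} [L.Structure N]

/-- The underlying `L'`-structure of an expansion. -/
def Expansions.str (σ : Expansions L L' N) : L'.Structure N := σ

/-- The `(L.sum L')`-structure on `N` determined by an expansion. -/
def Expansions.str0 (σ : Expansions L L' N) : (L.sum L').Structure N :=
  letI := σ.str
  inferInstance

/-- `(N, σ)` realizes the `L₀`-formula `φ` at the tuple `c` of parameters. -/
def Expansions.Realizes (σ : Expansions L L' N) {n : ℕ}
    (φ : (L.sum L').Formula (Fin n)) (c : Fin n → N) : Prop :=
  letI := σ.str0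
  φ.Realize c

/-- `(N, σ)` is a model of the `L₀`-theory `T₀`. -/
def Expansions.ModelsTh (σ : Expansions L L' N) (T₀ : (L.sum L').Theory) : Prop :=
  letI := σ.str0
  N ⊨ T₀

/-- The topology on `Exp(N)` generated by the sets `[φ]_N` for quantifier-free
`L₀`-sentences `φ` with parameters in `N` (coded as formulas plus an assignment). -/
instance (L L' : FirstOrder.Language.{0,0}) (N : Type) [L.Structure N] :
    TopologicalSpace (Expansions L L' N) :=
  TopologicalSpace.generateFrom
    {s | ∃ (n : ℕ) (φ : (L.sum L').Formula (Fin n)) (c : Fin n → N),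
      φ.IsQF ∧ s = {σ : Expansions L L' N | σ.Realizes φ c}}

/-- `Exp(N, T₀)`, as a subset of `Exp(N)`. -/
def ExpSet (L L' : FirstOrder.Language.{0,0}) (N : Type) [L.Structure N] (T₀ : (L.sum L').Theory) :
    Set (Expansions L L' N) :=
  {σ | σ.ModelsTh T₀}

/-- An `L₀`-sentence is universal modulo `T` if it is equivalent to a universal sentence
in every model of `T`. -/
def UniversalModulo (L L' : FirstOrder.Language.{0,0}) (T : L.Theory) (φ : (L.sum L').Sentence) : Prop :=
  ∃ ψ : (L.sum L').Sentence, BoundedFormula.IsUniversal ψ ∧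
    ∀ (U : Type) [L.Structure U] [L'.Structure U], U ⊨ T → (U ⊨ φ ↔ U ⊨ ψ)

/-- A theory is universal modulo `T` if all its sentences are. -/
def UniversalTheoryModulo (L L' : FirstOrder.Language.{0,0}) (T : L.Theory)
    (T₀ : (L.sum L').Theory) : Prop :=
  ∀ φ ∈ T₀, UniversalModulo L L' T φ

/-- `T` has quantifier elimination. -/
def HasQE (L : FirstOrder.Language.{0,0}) (T : L.Theory) : Prop :=
  ∀ (n : ℕ) (φ : L.Formula (Fin n)), ∃ ψ : L.Formula (Fin n), ψ.IsQF ∧ T ⊨ᵇ φ.iff ψ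

/-- `T` is small: countably many complete `n`-types for every `n`. -/
def IsSmall (L : FirstOrder.Language.{0,0}) (T : L.Theory) : Prop :=
  ∀ n : ℕ, Countable (T.CompleteType (Fin n))

/-- `N` is (ω-)saturated: every finitely realized set of `L`-formulas in one variable
with finitely many parameters in `N` is realized in `N`. -/
def IsSaturated (L : FirstOrder.Language.{0,0}) (N : Type) [L.Structure N] : Prop :=
  ∀ (k : ℕ) (c : Fin k → N) (p : Set (L.Formula (Fin k ⊕ Fin 1))),
    (∀ s : Finset (L.Formula (Fin k ⊕ Fin 1)), ↑s ⊆ p →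
      ∃ x : N, ∀ φ ∈ s, φ.Realize (Sum.elim c fun _ => x)) →
    ∃ x : N, ∀ φ ∈ p, φ.Realize (Sum.elim c fun _ => x)

/-- `σ` is an existentially closed expansion: every quantifier-free `L₀`-formula with
parameters in `N` that has a solution in some model of `T₀` extending `(N, σ)` has a
solution in `(N, σ)`. -/
def Expansions.IsEC (σ : Expansions L L' N) (T₀ : (L.sum L').Theory) : Prop :=
  letI := σ.str0
  ∀ (k n : ℕ) (φ : (L.sum L').Formula (Fin k ⊕ Fin n)) (c : Fin k → N), φ.IsQF →
    (∃ (U : Type) (iU : L.Structure U) (iU' : L'.Structure U),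
      letI := iU; letI := iU';
      ∃ _j : N ↪[L.sum L'] U, (U ⊨ T₀) ∧ ∃ x : Fin n → U, φ.Realize (Sum.elim (_j ∘ c) x)) →
    ∃ x : Fin n → N, φ.Realize (Sum.elim c x)

/-- `σ` is a smooth expansion: it realizes every finitely consistent type of the form
`p↾L(x) ∪ {ψ(x)}` with `ψ` quantifier-free in `L₀` and `p↾L` an `L`-type with finitely
many parameters. -/
def Expansions.IsSmooth (σ : Expansions L L' N) : Prop :=
  letI := σ.str0
  ∀ (k n : ℕ) (c : Fin k → N) (p : Set (L.Formula (Fin k ⊕ Fin n)))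
    (ψ : (L.sum L').Formula (Fin k ⊕ Fin n)), ψ.IsQF →
    (∀ s : Finset (L.Formula (Fin k ⊕ Fin n)), ↑s ⊆ p →
      ∃ x : Fin n → N, ψ.Realize (Sum.elim c x) ∧
        ∀ χ ∈ s, Formula.Realize (L := L) (M := N) χ (Sum.elim c x)) →
    ∃ x : Fin n → N, ψ.Realize (Sum.elim c x) ∧
      ∀ χ ∈ p, Formula.Realize (L := L) (M := N) χ (Sum.elim c x)

/-- The set `Y` of smooth existentially closed expansions in `Exp(N, T₀)`. -/
def YSet (L L' : FirstOrder.Language.{0,0}) (N : Type) [L.Structure N] (T₀ : (L.sum L').Theory) :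
    Set (Expansions L L' N) :=
  {σ | σ.ModelsTh T₀ ∧ σ.IsSmooth ∧ σ.IsEC T₀}


/-- A general existentially closed model of `T₀` (in the class of models of `T₀`). -/
def IsECModel (L L' : FirstOrder.Language.{0,0}) (T₀ : (L.sum L').Theory)
    (U : Type) [L.Structure U] [L'.Structure U] : Prop :=
  (U ⊨ T₀) ∧
  ∀ (k n : ℕ) (φ : (L.sum L').Formula (Fin k ⊕ Fin n)) (c : Fin k → U), φ.IsQF →
    (∃ (V : Type) (iV : L.Structure V) (iV' : L'.Structure V),
      letI := iV; letI := iV';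
      ∃ _j : U ↪[L.sum L'] V, (V ⊨ T₀) ∧ ∃ x : Fin n → V, φ.Realize (Sum.elim (_j ∘ c) x)) →
    ∃ x : Fin n → U, φ.Realize (Sum.elim c x)

/-- All existentially closed models of `T₀` have the same existential theory. -/
def SameExistentialTheory (L L' : FirstOrder.Language.{0,0}) (T₀ : (L.sum L').Theory) : Prop :=
  ∀ (U : Type) [L.Structure U] [L'.Structure U] (V : Type) [L.Structure V] [L'.Structure V],
    IsECModel L L' T₀ U → IsECModel L L' T₀ V →
    ∀ φ : (L.sum L').Sentence, BoundedFormula.IsExistential φ → ((U ⊨ φ) ↔ (V ⊨ φ))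

/-- An existential quasifinite formula `∃ y (p(x,y) ∧ φ(x,y))`, where `p` is a
parameter-free `L`-type and `φ` is a quantifier-free `L₀`-formula. -/
structure EQF (L L' : FirstOrder.Language.{0,0}) (n : ℕ) : Type where
  m : ℕ
  p : Set (L.Formula (Fin n ⊕ Fin m))
  φ : (L.sum L').Formula (Fin n ⊕ Fin m)
  qf : φ.IsQF

/-- Realization of an existential quasifinite formula at a tuple `b` in `(N, σ)`. -/
def EQF.RealizeAt {n : ℕ} (π : EQF L L' n) (σ : Expansions L L' N) (b : Fin n → N) : Prop :=
  letI := σ.str0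
  ∃ y : Fin π.m → N,
    (∀ χ ∈ π.p, Formula.Realize (L := L) (M := N) χ (Sum.elim b y)) ∧
      π.φ.Realize (Sum.elim b y)

/-- The complete parameter-free `L₀`-type of the tuple `a` in `(N, σ)`. -/
def fullType (σ : Expansions L L' N) {n : ℕ} (a : Fin n → N) :
    Set ((L.sum L').Formula (Fin n)) :=
  {φ | σ.Realizes φ a}

/-- `p↾1`: the universal and existential formulas in `p`. -/
def restr1 {L L' : FirstOrder.Language.{0,0}} {n : ℕ}
    (p : Set ((L.sum L').Formula (Fin n))) : Set ((L.sum L').Formula (Fin n)) :=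
  {φ ∈ p | BoundedFormula.IsUniversal φ ∨ BoundedFormula.IsExistential φ}

/-- The 1-diagram of `σ` at `b`: all universal and existential formulas satisfied by `b`
in `(N, σ)` (coding sentences with parameters `b` as formulas). -/
def diag1 (σ : Expansions L L' N) {n : ℕ} (b : Fin n → N) :
    Set ((L.sum L').Formula (Fin n)) :=
  restr1 (fullType σ b)

variable (L L' N) in
/-- The set `D_b` of 1-diagrams at `b` of expansions in `Y`. -/
def DSet (T₀ : (L.sum L').Theory) {n : ℕ} (b : Fin n → N) :
    Set (Set ((L.sum L').Formula (Fin n))) :=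
  {d | ∃ σ ∈ YSet L L' N T₀, d = diag1 σ b}

variable (L L' N) in
/-- The basic subset `[π(b)]_D` of `D_b`. -/
def DBasic (T₀ : (L.sum L').Theory) {n : ℕ} (b : Fin n → N) (π : EQF L L' n) :
    Set (Set ((L.sum L').Formula (Fin n))) :=
  {d | ∃ σ ∈ YSet L L' N T₀, d = diag1 σ b ∧ π.RealizeAt σ b}

variable (L L' N) in
/-- The topology on `D_b` generated by the sets `[π(b)]_D`. -/
def DTop (T₀ : (L.sum L').Theory) {n : ℕ} (b : Fin n → N) :
    TopologicalSpace ↥(DSet L L' N T₀ b) :=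
  TopologicalSpace.generateFrom
    {s | ∃ π : EQF L L' n, s = {d | ↑d ∈ DBasic L L' N T₀ b π}}

variable (L L' N) in
/-- The set `S_x^Y` of types `p↾1` for `p` a complete parameter-free type realized in `Y`. -/
def SSet (T₀ : (L.sum L').Theory) (n : ℕ) : Set (Set ((L.sum L').Formula (Fin n))) :=
  {q | ∃ σ ∈ YSet L L' N T₀, ∃ a : Fin n → N, q = diag1 σ a}

variable (L L' N) in
/-- The basic subset `[π(x)]_S` of `S_x^Y`. -/
def SBasic (T₀ : (L.sum L').Theory) {n : ℕ} (π : EQF L L' n) :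
    Set (Set ((L.sum L').Formula (Fin n))) :=
  {q | ∃ σ ∈ YSet L L' N T₀, ∃ a : Fin n → N, q = diag1 σ a ∧ π.RealizeAt σ a}

variable (L L' N) in
/-- The topology on `S_x^Y` generated by the sets `[π(x)]_S`. -/
def STop (T₀ : (L.sum L').Theory) (n : ℕ) : TopologicalSpace ↥(SSet L L' N T₀ n) :=
  TopologicalSpace.generateFrom
    {s | ∃ π : EQF L L' n, s = {q | ↑q ∈ SBasic L L' N T₀ π}}

variable (L L' N) in
/-- `α` is an e-atomic expansion: it is in `Y` and each of its 1-diagrams is an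
isolated point of `D_b`. -/
def IsEAtomic (T₀ : (L.sum L').Theory) (α : Expansions L L' N) : Prop :=
  α ∈ YSet L L' N T₀ ∧ ∀ (n : ℕ) (b : Fin n → N),
    @IsOpen _ (DTop L L' N T₀ b) {d | (d : Set ((L.sum L').Formula (Fin n))) = diag1 α b}

/-- The conjugate expansion `σ^g` of `σ` under an automorphism `g` of `N`. -/
def conjExp (g : N ≃[L] N) (σ : Expansions L L' N) : Expansions L L' N :=
  show L'.Structure N from
  { funMap := fun {_} F a => g ((σ.str).funMap F fun i => g.symm (a i))
    RelMap := fun {_} R a => (σ.str).RelMap R fun i => g.symm (a i) }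

variable (L L' N) in
/-- `τ` is Truss generic: its conjugacy class is comeagre in `Exp(N, T₀)`. -/
def IsTrussGeneric (T₀ : (L.sum L').Theory) (τ : Expansions L L' N) : Prop :=
  τ.ModelsTh T₀ ∧
    {σ : ↥(ExpSet L L' N T₀) | ∃ g : N ≃[L] N, (σ : Expansions L L' N) = conjExp g τ} ∈
      residual ↥(ExpSet L L' N T₀)


variable (L L' N) in
/-- The quantifier-free formula `φ` (with parameters `c`) has a solution in `(N, σ)`. -/
def SolvableIn (σ : Expansions L L' N) {k n : ℕ}
    (φ : (L.sum L').Formula (Fin k ⊕ Fin n)) (c : Fin k → N) : Prop :=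
  letI := σ.str0
  ∃ x : Fin n → N, φ.Realize (Sum.elim c x)

variable (L L' N) in
/-- The formula `φ` (with parameters `c`) has a solution in some model of `T₀`
extending `(N, σ)`. -/
def SolvableInExtension (T₀ : (L.sum L').Theory) (σ : Expansions L L' N) {k n : ℕ}
    (φ : (L.sum L').Formula (Fin k ⊕ Fin n)) (c : Fin k → N) : Prop :=
  letI := σ.str0
  ∃ (U : Type) (iU : L.Structure U) (iU' : L'.Structure U),
    letI := iU; letI := iU';
    ∃ _j : N ↪[L.sum L'] U, (U ⊨ T₀) ∧ ∃ x : Fin n → U, φ.Realize (Sum.elim (_j ∘ c) x)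

section Compactness

variable {K : FirstOrder.Language.{0,0}}

/-- The quantifier-free diagram of a structure on `A`: quantifier-free formulas with
parameters in `A` that hold in the structure. -/
def QFDiagram {A : Type} (S : K.Structure A) : Type :=
  {i : Σ m : ℕ, K.Formula (Fin m) × (Fin m → A) // i.2.1.IsQF ∧ i.2.1.Realize i.2.2}

/-- A map preserving the quantifier-free diagram of `A` is an embedding. -/
theorem exists_embedding_of_forall_qfDiagram {A U : Type} (S : K.Structure A) [K.Structure U]
    (j : A → U)
    (h : ∀ i : QFDiagram S, i.1.2.1.Realize (j ∘ i.1.2.2)) :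
    ∃ e : A ↪[K] U, ⇑e = j := by
  have key : ∀ (m : ℕ) (χ : K.Formula (Fin m)) (c : Fin m → A), χ.IsQF →
      (χ.Realize (j ∘ c) ↔ χ.Realize c) := by
    intro m χ c hχ
    refine ⟨fun h1 => ?_, fun h1 => h ⟨⟨m, χ, c⟩, hχ, h1⟩⟩
    by_contra h2
    have h3 := h ⟨⟨m, χ.not, c⟩, hχ.not, h2⟩
    exact h3 h1
  refine ⟨⟨⟨j, ?_⟩, ?_, ?_⟩, rfl⟩
  · intro a a' haa
    have := key 2 ((Term.var 0).equal (Term.var 1)) ![a, a']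
      (BoundedFormula.IsAtomic.equal _ _).isQF
    simpa [Formula.realize_equal, haa] using this
  · intro m f x
    have := key (m + 1) ((Term.func f fun i => Term.var i.castSucc).equal
      (Term.var (Fin.last m))) (Fin.snoc x (Structure.funMap f x))
      (BoundedFormula.IsAtomic.equal _ _).isQF
    simp [Formula.realize_equal] at this
    exact this.symm
  · intro m R x
    exact key m (R.formula fun i => Term.var i) x (BoundedFormula.IsAtomic.rel _ _).isQF

/-- Compactness: if every finite part of the quantifier-free diagram of `S` is satisfied by
some structure on `A` which models `T₀` and has a solution of `ψ(c, y)`, then `S` has an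
extension which models `T₀` and has a solution of `ψ(c, y)`. -/
theorem exists_extension_of_finite {A : Type} [Nonempty A] (S : K.Structure A) (T₀ : K.Theory)
    {k n : ℕ} (ψ : K.Formula (Fin k ⊕ Fin n)) (c : Fin k → A)
    (h : ∀ F : Finset (QFDiagram S), ∃ _ : K.Structure A, A ⊨ T₀ ∧
      (∀ i ∈ F, i.1.2.1.Realize i.1.2.2) ∧ ∃ y : Fin n → A, ψ.Realize (Sum.elim c y)) :
    ∃ (U : Type) (_ : K.Structure U) (e : @Language.Embedding K A U S _), U ⊨ T₀ ∧
      ∃ y : Fin n → U, ψ.Realize (Sum.elim (e.toFun ∘ c) y) := by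
  let base : K[[A ⊕ Fin n]].Theory :=
    (K.lhomWithConstants (A ⊕ Fin n)).onTheory T₀ ∪
      {Formula.equivSentence (ψ.relabel (Sum.map c id))}
  let Γ : QFDiagram S → K[[A ⊕ Fin n]].Theory := fun i =>
    base ∪ {Formula.equivSentence (i.1.2.1.relabel (Sum.inl ∘ i.1.2.2))}
  have hsat : Theory.IsSatisfiable (⋃ i, Γ i) := by
    rw [Theory.isSatisfiable_iUnion_iff_isSatisfiable_iUnion_finset]
    intro F
    obtain ⟨S', hT, hF, y, hy⟩ := h F
    let : (constantsOn (A ⊕ Fin n)).Structure A := constantsOn.structure (Sum.elim id y)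
    have hm : A ⊨ ⋃ i ∈ F, Γ i := by
      have hb : A ⊨ base := by
        refine ((LHom.onTheory_model _ _).2 hT).union ?_
        rw [Theory.model_singleton_iff, Formula.realize_equivSentence, Formula.realize_relabel]
        convert hy using 1
        funext x
        cases x <;> rfl
      refine ⟨fun φ hφ => ?_⟩
      simp only [Set.mem_iUnion] at hφ
      obtain ⟨i, hi, hφ⟩ := hφ
      rcases hφ with hφ | hφ
      · exact hb.realize_of_mem φ hφ
      · rw [Set.mem_singleton_iff] at hφ
        rw [hφ, Formula.realize_equivSentence, Formula.realize_relabel]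
        exact hF i hi
    exact Theory.Model.isSatisfiable A
  obtain ⟨U⟩ := hsat
  have hU : ∀ i, (U : Type) ⊨ Γ i := fun i =>
    U.is_model.mono (Set.subset_iUnion Γ i)
  let iK : K.Structure U := (K.lhomWithConstants (A ⊕ Fin n)).reduct U
  have hexp : (K.lhomWithConstants (A ⊕ Fin n)).IsExpansionOn U :=
    LHom.isExpansionOn_reduct _ _
  let j : A ⊕ Fin n → U := fun a => (K.con a : U)
  let i₀ : QFDiagram S := ⟨⟨0, ⊤, Fin.elim0⟩, BoundedFormula.IsQF.top, by simp⟩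
  have hd : ∀ i : QFDiagram S, i.1.2.1.Realize ((j ∘ Sum.inl) ∘ i.1.2.2) := by
    intro i
    have := (hU i).realize_of_mem (Formula.equivSentence (i.1.2.1.relabel (Sum.inl ∘ i.1.2.2)))
      (Or.inr rfl)
    rw [Formula.realize_equivSentence, Formula.realize_relabel] at this
    exact this
  obtain ⟨e, he⟩ := exists_embedding_of_forall_qfDiagram S (j ∘ Sum.inl) hd
  have hT : (U : Type) ⊨ T₀ := (LHom.onTheory_model (K.lhomWithConstants (A ⊕ Fin n)) T₀).1
    ((hU i₀).mono (Set.subset_union_left.trans Set.subset_union_left))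
  refine ⟨U, iK, e, hT, j ∘ Sum.inr, ?_⟩
  have := (hU i₀).realize_of_mem (Formula.equivSentence (ψ.relabel (Sum.map c id)))
    (Or.inl (Or.inr rfl))
  rw [Formula.realize_equivSentence, Formula.realize_relabel] at this
  convert this using 1
  funext x
  cases x with
  | inl a => exact congrFun he (c a)
  | inr a => rfl

end Compactness

section Prenex

variable {K : FirstOrder.Language.{0,0}} {α : Type}

theorem isQF_toFormula {n : ℕ} {φ : K.BoundedFormula α n} (h : φ.IsQF) : φ.toFormula.IsQF := by
  induction h with
  | falsum => exact .falsum
  | of_isAtomic h =>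
    cases h with
    | equal => exact (BoundedFormula.IsAtomic.equal _ _).isQF
    | rel => exact (BoundedFormula.IsAtomic.rel _ _).isQF
  | imp _ _ h₁ h₂ => exact h₁.imp h₂

/-- An existential formula is a block of existential quantifiers over a quantifier-free one. -/
theorem exists_qf_of_isExistential {n : ℕ} {φ : K.BoundedFormula α n} (h : φ.IsExistential) :
    ∃ (k : ℕ) (ψ : K.Formula ((α ⊕ Fin n) ⊕ Fin k)), ψ.IsQF ∧
      ∀ (U : Type) [K.Structure U] (v : α → U) (xs : Fin n → U),
        φ.Realize v xs ↔ ∃ y : Fin k → U, ψ.Realize (Sum.elim (Sum.elim v xs) y) := by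
  induction h with
  | of_isQF h =>
    rename_i φ
    refine ⟨0, φ.toFormula.relabel Sum.inl, (isQF_toFormula h).relabel _, fun U _ v xs => ?_⟩
    simp [Formula.realize_relabel, BoundedFormula.realize_toFormula, Function.comp_def]
  | ex h ih =>
    rename_i n φ
    obtain ⟨k, ψ, hψ, H⟩ := ih
    let g : (α ⊕ Fin (n + 1)) ⊕ Fin k → (α ⊕ Fin n) ⊕ Fin (k + 1) :=
      Sum.elim (Sum.elim (fun a => .inl (.inl a))
        (Fin.snoc (α := fun _ => (α ⊕ Fin n) ⊕ Fin (k + 1)) (fun i => .inl (.inr i)) (.inr 0)))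
        (fun i => .inr i.succ)
    refine ⟨k + 1, ψ.relabel g, hψ.relabel _, fun U _ v xs => ?_⟩
    have hg : ∀ (u : U) (y : Fin k → U),
        Sum.elim (Sum.elim v xs) (Fin.cons u y : Fin (k + 1) → U) ∘ g =
          Sum.elim (Sum.elim v (Fin.snoc xs u)) y := by
      intro u y
      funext z
      rcases z with (a | i) | i
      · rfl
      · induction i using Fin.lastCases <;> simp [g]
      · simp [g]
    rw [BoundedFormula.realize_ex]
    simp only [H, Formula.realize_relabel]
    constructor
    · rintro ⟨u, y, hy⟩
      exact ⟨Fin.cons u y, by rwa [hg]⟩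
    · rintro ⟨y, hy⟩
      refine ⟨y 0, Fin.tail y, ?_⟩
      rwa [← hg, Fin.cons_self_tail]

theorem exists_qf_formula_of_isExistential {φ : K.Formula α}
    (h : BoundedFormula.IsExistential φ) :
    ∃ (k : ℕ) (ψ : K.Formula (α ⊕ Fin k)), ψ.IsQF ∧
      ∀ (U : Type) [K.Structure U] (v : α → U),
        φ.Realize v ↔ ∃ y : Fin k → U, ψ.Realize (Sum.elim v y) := by
  obtain ⟨k, ψ, hψ, H⟩ := exists_qf_of_isExistential h
  refine ⟨k, ψ.relabel (Sum.map (Sum.elim id Fin.elim0) id), hψ.relabel _, fun U _ v => ?_⟩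
  rw [Formula.Realize, H]
  simp only [Formula.realize_relabel]
  refine exists_congr fun y => ?_
  have : Sum.elim v y ∘ Sum.map (Sum.elim id Fin.elim0) id =
      Sum.elim (Sum.elim v default) y := by
    funext z
    rcases z with (a | i) | i
    · rfl
    · exact i.elim0
    · rfl
  rw [this]

theorem exists_isExistential_not {n : ℕ} {φ : K.BoundedFormula α n} (h : φ.IsUniversal) :
    ∃ ψ : K.BoundedFormula α n, ψ.IsExistential ∧
      ∀ (U : Type) [K.Structure U] (v : α → U) (xs : Fin n → U),
        ψ.Realize v xs ↔ ¬ φ.Realize v xs := by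
  induction h with
  | of_isQF h => exact ⟨_, h.not.isExistential, fun U _ v xs => by simp⟩
  | all h ih =>
    obtain ⟨ψ, hψ, H⟩ := ih
    exact ⟨ψ.ex, hψ.ex, fun U _ v xs => by simp [H]⟩

theorem exists_isUniversal_not {n : ℕ} {φ : K.BoundedFormula α n} (h : φ.IsExistential) :
    ∃ ψ : K.BoundedFormula α n, ψ.IsUniversal ∧
      ∀ (U : Type) [K.Structure U] (v : α → U) (xs : Fin n → U),
        ψ.Realize v xs ↔ ¬ φ.Realize v xs := by
  induction h with
  | of_isQF h => exact ⟨_, h.not.isUniversal, fun U _ v xs => by simp⟩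
  | ex h ih =>
    obtain ⟨ψ, hψ, H⟩ := ih
    exact ⟨ψ.all, hψ.all, fun U _ v xs => by simp [H]⟩

end Prenex

section Homogeneity

variable {K : FirstOrder.Language.{0,0}} {M : Type} [K.Structure M]

/-- A relation on `M` is elementary if corresponding tuples have the same type. -/
def IsElementaryRel (K : FirstOrder.Language.{0,0}) {M : Type} [K.Structure M]
    (S : Set (M × M)) : Prop :=
  ∀ (m : ℕ) (w : Fin m → M × M), (∀ i, w i ∈ S) → ∀ φ : K.Formula (Fin m),
    φ.Realize (fun i => (w i).1) ↔ φ.Realize (fun i => (w i).2)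

theorem isElementaryRel_range {ι : Type} [Finite ι] {w : ι → M × M}
    (h : ∀ φ : K.Formula ι, φ.Realize (fun i => (w i).1) ↔ φ.Realize (fun i => (w i).2)) :
    IsElementaryRel K (Set.range w) := by
  intro m v hv φ
  choose f hf using hv
  have := h (φ.relabel f)
  simp only [Formula.realize_relabel, Function.comp_def, hf] at this
  exact this

theorem IsElementaryRel.swap {S : Set (M × M)} (h : IsElementaryRel K S) :
    IsElementaryRel K (Prod.swap ⁻¹' S) :=
  fun m w hw φ => (h m (fun i => (w i).swap) hw φ).symm

theorem IsElementaryRel.exists_insert (hsat : IsSaturated K M) {S : Set (M × M)} (hfin : S.Finite)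
    (h : IsElementaryRel K S) (a : M) :
    ∃ a', IsElementaryRel K (insert (a, a') S) := by
  obtain ⟨k, w, -, hw⟩ := hfin.fin_param
  have hS : ∀ i, w i ∈ S := fun i => hw ▸ Set.mem_range_self i
  obtain ⟨a', ha'⟩ := hsat k (fun i => (w i).2)
    {φ | φ.Realize (Sum.elim (fun i => (w i).1) fun _ => a)} (by
      intro s hs
      let χ : K.Formula (Fin k ⊕ Fin 1) := Formula.iInf fun φ : s => φ.1
      have h1 : (χ.iExs (Fin 1)).Realize fun i => (w i).1 := by
        rw [Formula.realize_iExs]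
        refine ⟨fun _ => a, ?_⟩
        rw [Formula.realize_iInf]
        exact fun φ => hs φ.2
      rw [h k w hS, Formula.realize_iExs] at h1
      obtain ⟨x, hx⟩ := h1
      rw [Formula.realize_iInf] at hx
      refine ⟨x 0, fun φ hφ => ?_⟩
      convert hx ⟨φ, hφ⟩ using 2
      funext i
      rw [Subsingleton.elim i 0])
  refine ⟨a', ?_⟩
  let w' : Fin k ⊕ Fin 1 → M × M := Sum.elim w fun _ => (a, a')
  have hr : insert (a, a') S = Set.range w' := by
    rw [Set.Sum.elim_range, hw, Set.range_const, Set.union_comm, Set.insert_eq]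
  have e1 : (fun i => (w' i).1) = Sum.elim (fun i => (w i).1) fun _ => a := by
    funext i; cases i <;> rfl
  have e2 : (fun i => (w' i).2) = Sum.elim (fun i => (w i).2) fun _ => a' := by
    funext i; cases i <;> rfl
  rw [hr]
  refine isElementaryRel_range fun φ => ?_
  rw [e1, e2]
  refine ⟨fun hφ => ha' φ hφ, fun hφ => ?_⟩
  by_contra hn
  exact ha' φ.not hn hφ

/-- A countable saturated structure is homogeneous. -/
theorem exists_equiv_of_isElementaryRel [Countable M] (hsat : IsSaturated K M) {S : Set (M × M)}
    (hfin : S.Finite) (h : IsElementaryRel K S) :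
    ∃ g : M ≃[K] M, ∀ x ∈ S, g x.1 = x.2 := by
  let P := {R : Set (M × M) // R.Finite ∧ IsElementaryRel K R}
  have ext1 : ∀ (R : P) (a : M), ∃ R' : P, R ≤ R' ∧ ∃ a', (a, a') ∈ R'.1 := by
    intro R a
    obtain ⟨a', ha'⟩ := R.2.2.exists_insert hsat R.2.1 a
    exact ⟨⟨_, R.2.1.insert _, ha'⟩, Set.subset_insert _ _, a', Set.mem_insert _ _⟩
  have ext2 : ∀ (R : P) (a : M), ∃ R' : P, R ≤ R' ∧ ∃ a', (a', a) ∈ R'.1 := by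
    intro R a
    have hf : (Prod.swap ⁻¹' R.1).Finite := R.2.1.preimage Prod.swap_injective.injOn
    obtain ⟨R', hR, a', ha'⟩ := ext1 ⟨_, hf, R.2.2.swap⟩ a
    exact ⟨⟨_, R'.2.1.preimage Prod.swap_injective.injOn, R'.2.2.swap⟩,
      fun x hx => hR (by simpa using hx), a', ha'⟩
  let D : M ⊕ M → Order.Cofinal P := Sum.elim
    (fun a => ⟨{R | ∃ a', (a, a') ∈ R.1}, fun R => by
      obtain ⟨R', h1, h2⟩ := ext1 R a
      exact ⟨R', h2, h1⟩⟩)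
    (fun a => ⟨{R | ∃ a', (a', a) ∈ R.1}, fun R => by
      obtain ⟨R', h1, h2⟩ := ext2 R a
      exact ⟨R', h2, h1⟩⟩)
  have := Encodable.ofCountable (M ⊕ M)
  let seq := Order.sequenceOfCofinals (⟨S, hfin, h⟩ : P) D
  have hmono : Monotone seq := Order.sequenceOfCofinals.monotone _ _
  let G : Set (M × M) := ⋃ n, (seq n).1
  have hG : IsElementaryRel K G := by
    intro m w hw φ
    choose f hf using fun i => Set.mem_iUnion.1 (hw i)
    obtain ⟨n, hn⟩ := Finite.bddAbove_range f
    exact (seq n).2.2 m w (fun i => hmono (hn (Set.mem_range_self i)) (hf i)) φ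
  have tot : ∀ a, ∃ a', (a, a') ∈ G := fun a => by
    obtain ⟨a', ha'⟩ := Order.sequenceOfCofinals.encode_mem (⟨S, hfin, h⟩ : P) D (.inl a)
    exact ⟨a', Set.mem_iUnion.2 ⟨_, ha'⟩⟩
  have sur : ∀ a, ∃ a', (a', a) ∈ G := fun a => by
    obtain ⟨a', ha'⟩ := Order.sequenceOfCofinals.encode_mem (⟨S, hfin, h⟩ : P) D (.inr a)
    exact ⟨a', Set.mem_iUnion.2 ⟨_, ha'⟩⟩
  have heq : ∀ {x y : M × M}, x ∈ G → y ∈ G → (x.1 = y.1 ↔ x.2 = y.2) := by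
    intro x y hx hy
    have := hG 2 ![x, y] (by simp [Fin.forall_fin_two, hx, hy])
      ((Term.var 0).equal (Term.var 1))
    simpa [Formula.realize_equal] using this
  choose g hg using tot
  choose g' hg' using sur
  refine ⟨⟨⟨g, g', fun a => (heq (hg' _) (hg _)).2 rfl, fun a => (heq (hg _) (hg' _)).1 rfl⟩,
    fun {m} f x => ?_, fun {m} r x => ?_⟩, fun x hx => ?_⟩
  · have := hG (m + 1) (Fin.snoc (fun i => (x i, g (x i)))
      (Structure.funMap f x, g (Structure.funMap f x)))
      (fun i => by induction i using Fin.lastCases <;> simp [hg])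
      ((Term.func f fun i => Term.var i.castSucc).equal (Term.var (Fin.last m)))
    simp [Formula.realize_equal] at this
    exact this.symm
  · exact (hG m (fun i => (x i, g (x i))) (fun i => hg _)
      (r.formula fun i => Term.var i)).symm
  · exact (heq (hg x.1) (Set.mem_iUnion.2 ⟨0, hx⟩)).1 rfl

end Homogeneity

section Conjugation

theorem realize_equiv_comp {K : FirstOrder.Language.{0,0}} {A B : Type} [K.Structure A]
    [K.Structure B] (e : A ≃[K] B) {α : Type} (φ : K.Formula α) (v : α → A) :
    φ.Realize (e.toEquiv ∘ v) ↔ φ.Realize v :=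
  StrongHomClass.realize_formula e φ

theorem model_of_equiv {K : FirstOrder.Language.{0,0}} {A B : Type} [K.Structure A]
    [K.Structure B] (e : A ≃[K] B) {T : K.Theory} (h : A ⊨ T) : B ⊨ T :=
  StrongHomClass.theory_model e

variable (g : N ≃[L] N) (τ : Expansions L L' N)

/-- An automorphism `g` of `N` is an isomorphism from `(N, τ)` to `(N, τ^g)`. -/
theorem exists_equiv_conjExp :
    ∃ e : @Language.Equiv (L.sum L') N N τ.str0 (conjExp g τ).str0,
      @Language.Equiv.toEquiv _ N N τ.str0 (conjExp g τ).str0 e = g.toEquiv := by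
  refine ⟨@Language.Equiv.mk _ _ _ τ.str0 (conjExp g τ).str0 g.toEquiv ?_ ?_, rfl⟩
  · intro m f x
    cases f with
    | inl f => exact g.map_fun f x
    | inr f =>
      refine congrArg (fun y => g ((τ.str).funMap f y)) (funext fun i => ?_)
      exact (g.symm_apply_apply (x i)).symm
  · intro m r x
    cases r with
    | inl r => exact g.map_rel r x
    | inr r =>
      refine iff_of_eq (congrArg (fun y => (τ.str).RelMap r y) (funext fun i => ?_))
      exact g.symm_apply_apply (x i)

theorem realize_conjExp {α : Type} (φ : (L.sum L').Formula α) (v : α → N) :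
    @Formula.Realize _ N (conjExp g τ).str0 _ φ (g ∘ v) ↔ @Formula.Realize _ N τ.str0 _ φ v := by
  obtain ⟨e, he⟩ := exists_equiv_conjExp g τ
  have h : (⇑g : N → N) = @Language.Equiv.toEquiv _ N N τ.str0 (conjExp g τ).str0 e := by
    rw [he]
    rfl
  rw [h]
  exact @realize_equiv_comp _ N N τ.str0 (conjExp g τ).str0 e _ φ v

variable {g τ} {T₀ : (L.sum L').Theory}

theorem Expansions.ModelsTh.conjExp (h : τ.ModelsTh T₀) : (conjExp g τ).ModelsTh T₀ := by
  obtain ⟨e, -⟩ := exists_equiv_conjExp g τ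
  exact @model_of_equiv _ N N τ.str0 (GenExp.conjExp g τ).str0 e T₀ h

theorem Expansions.IsEC.conjExp (h : τ.IsEC T₀) : (conjExp g τ).IsEC T₀ := by
  obtain ⟨e, he⟩ := exists_equiv_conjExp g τ
  intro k n φ c hφ ⟨U, iU, iU', j, hU, x, hx⟩
  obtain ⟨y, hy⟩ := h k n φ (g.symm ∘ c) hφ
    ⟨U, iU, iU', @Embedding.comp _ N N τ.str0 (GenExp.conjExp g τ).str0 U _ j
      (@Language.Equiv.toEmbedding _ N N τ.str0 (GenExp.conjExp g τ).str0 e), hU, x, by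
      convert hx using 2
      funext i
      refine congrArg j ?_
      change @Language.Equiv.toEquiv _ N N τ.str0 (GenExp.conjExp g τ).str0 e (g.symm (c i)) = c i
      rw [he]
      exact g.apply_symm_apply (c i)⟩
  refine ⟨g ∘ y, ?_⟩
  rw [← realize_conjExp g τ] at hy
  convert hy using 1
  funext i
  cases i with
  | inl i => exact (g.apply_symm_apply (c i)).symm
  | inr i => rfl

theorem Expansions.IsSmooth.conjExp (h : τ.IsSmooth) : (conjExp g τ).IsSmooth := by
  intro k n c p ψ hψ hp
  have hv : ∀ x : Fin n → N, g ∘ Sum.elim (g.symm ∘ c) x = Sum.elim c (g ∘ x) := by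
    intro x
    funext i
    cases i with
    | inl i => exact g.apply_symm_apply (c i)
    | inr i => rfl
  have hψ' : ∀ x : Fin n → N, @Formula.Realize _ N τ.str0 _ ψ (Sum.elim (g.symm ∘ c) x) ↔
      @Formula.Realize _ N (GenExp.conjExp g τ).str0 _ ψ (Sum.elim c (g ∘ x)) := fun x => by
    rw [← realize_conjExp g τ, hv]
  have hχ' : ∀ (χ : L.Formula (Fin k ⊕ Fin n)) (x : Fin n → N),
      χ.Realize (Sum.elim (g.symm ∘ c) x) ↔ χ.Realize (Sum.elim c (g ∘ x)) := fun χ x => by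
    rw [← StrongHomClass.realize_formula g, hv]
  obtain ⟨x, hx, hx'⟩ := h k n (g.symm ∘ c) p ψ hψ fun s hs => by
    obtain ⟨x, hx, hx'⟩ := hp s hs
    have hgx : g ∘ g.symm ∘ x = x := funext fun i => g.apply_symm_apply (x i)
    refine ⟨g.symm ∘ x, ?_, fun χ hχ => ?_⟩
    · rw [hψ', hgx]
      exact hx
    · rw [hχ', hgx]
      exact hx' χ hχ
  exact ⟨g ∘ x, (hψ' x).1 hx, fun χ hχ => (hχ' χ x).1 (hx' χ hχ)⟩

theorem conjExp_mem_YSet (h : τ ∈ YSet L L' N T₀) : conjExp g τ ∈ YSet L L' N T₀ :=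
  ⟨h.1.conjExp, h.2.1.conjExp, h.2.2.conjExp⟩

end Conjugation

section Topology

theorem isOpen_realize_of_isQF {α : Type} [Finite α] {φ : (L.sum L').Formula α} (hφ : φ.IsQF)
    (v : α → N) : IsOpen {σ : Expansions L L' N | @Formula.Realize _ N σ.str0 _ φ v} := by
  obtain ⟨n, ⟨e⟩⟩ := Finite.exists_equiv_fin α
  refine TopologicalSpace.isOpen_generateFrom_of_mem
    ⟨n, φ.relabel e, v ∘ e.symm, hφ.relabel _, ?_⟩
  ext σ
  let := σ.str0
  change φ.Realize v ↔ Formula.Realize (φ.relabel e) (v ∘ e.symm)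
  rw [Formula.realize_relabel, Function.comp_assoc, e.symm_comp_self, Function.comp_id]

/-- Every open neighbourhood contains a basic one, given by a single quantifier-free formula. -/
theorem exists_qf_of_isOpen {O : Set (Expansions L L' N)} (hO : IsOpen O)
    {σ : Expansions L L' N} (hσ : σ ∈ O) :
    ∃ (m : ℕ) (θ : (L.sum L').Formula (Fin m)) (c : Fin m → N), θ.IsQF ∧ σ.Realizes θ c ∧
      ∀ τ : Expansions L L' N, τ.Realizes θ c → τ ∈ O := by
  induction hO with
  | basic s hs =>
    obtain ⟨m, θ, c, hθ, rfl⟩ := hs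
    exact ⟨m, θ, c, hθ, hσ, fun τ h => h⟩
  | univ =>
    refine ⟨0, ⊤, Fin.elim0, BoundedFormula.IsQF.top, ?_, fun τ _ => trivial⟩
    let := σ.str0
    exact Formula.realize_top.2 trivial
  | inter s t _ _ hs ht =>
    obtain ⟨m₁, θ₁, c₁, hθ₁, h₁, H₁⟩ := hs hσ.1
    obtain ⟨m₂, θ₂, c₂, hθ₂, h₂, H₂⟩ := ht hσ.2
    have key : ∀ τ : Expansions L L' N, τ.Realizes (θ₁.relabel (Fin.castAdd m₂) ⊓
        θ₂.relabel (Fin.natAdd m₁)) (Fin.append c₁ c₂) ↔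
        τ.Realizes θ₁ c₁ ∧ τ.Realizes θ₂ c₂ := by
      intro τ
      let := τ.str0
      change Formula.Realize (_ ⊓ _) _ ↔ θ₁.Realize c₁ ∧ θ₂.Realize c₂
      rw [Formula.realize_inf, Formula.realize_relabel, Formula.realize_relabel]
      simp [Function.comp_def]
    exact ⟨_, _, _, (hθ₁.relabel _).inf (hθ₂.relabel _), (key σ).2 ⟨h₁, h₂⟩, fun τ hτ =>
      ⟨H₁ τ ((key τ).1 hτ).1, H₂ τ ((key τ).1 hτ).2⟩⟩
  | sUnion S _ ih =>
    obtain ⟨s, hs, hσs⟩ := hσ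
    obtain ⟨m, θ, c, hθ, h, H⟩ := ih s hs hσs
    exact ⟨m, θ, c, hθ, h, fun τ hτ => ⟨s, hs, H τ hτ⟩⟩

/-- Every structure for `L.sum L'` is the sum of its reducts. -/
theorem exists_eq_sumStructure {U : Type} (S : (L.sum L').Structure U) :
    ∃ (_ : L.Structure U) (_ : L'.Structure U), S = Language.sumStructure L L' U := by
  refine ⟨LHom.reduct (LHom.sumInl : L →ᴸ L.sum L') U,
    LHom.reduct (LHom.sumInr : L' →ᴸ L.sum L') U, ?_⟩
  ext m f x
  · cases f <;> rfl
  · cases f <;> rfl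

/-- Failure of an existential formula in an existentially closed expansion holds on a
neighbourhood, among models of `T₀`. -/
theorem exists_isOpen_not_realizes {T₀ : (L.sum L').Theory} {σ : Expansions L L' N}
    (hσ : σ.IsEC T₀) {n : ℕ} {φ : (L.sum L').Formula (Fin n)}
    (hφ : BoundedFormula.IsExistential φ) {b : Fin n → N} (hb : ¬ σ.Realizes φ b) :
    ∃ O : Set (Expansions L L' N), IsOpen O ∧ σ ∈ O ∧
      ∀ τ ∈ O, τ.ModelsTh T₀ → ¬ τ.Realizes φ b := by
  obtain ⟨k, ψ, hψ, H⟩ := exists_qf_formula_of_isExistential hφ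
  have H' : ∀ τ : Expansions L L' N, τ.Realizes φ b ↔
      ∃ y : Fin k → N, @Formula.Realize _ N τ.str0 _ ψ (Sum.elim b y) := fun τ =>
    @H N τ.str0 b
  simp only [H'] at hb ⊢
  cases k with
  | zero =>
    refine ⟨_, isOpen_realize_of_isQF hψ.not (Sum.elim b default), fun h => hb ⟨_, h⟩, ?_⟩
    rintro τ hτ - ⟨y, hy⟩
    rw [Subsingleton.elim y default] at hy
    exact hτ hy
  | succ k =>
    by_cases hN : Nonempty N
    swap
    · exact ⟨Set.univ, isOpen_univ, trivial, fun τ _ _ ⟨y, _⟩ => hN ⟨y 0⟩⟩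
    by_contra! hcon
    obtain ⟨U, S, e, hU, y, hy⟩ := exists_extension_of_finite σ.str0 T₀ ψ b fun F => by
      obtain ⟨τ, hτ, hτT, hy⟩ := hcon
        (⋂ i ∈ F, {τ | @Formula.Realize _ N τ.str0 _ i.1.2.1 i.1.2.2})
        (isOpen_biInter_finset fun i _ => isOpen_realize_of_isQF i.2.1 _)
        (Set.mem_iInter₂.2 fun i _ => i.2.2)
      exact ⟨τ.str0, hτT, fun i hi => Set.mem_iInter₂.1 hτ i hi, hy⟩
    obtain ⟨iU, iU', rfl⟩ := exists_eq_sumStructure S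
    exact hb (hσ n (k + 1) ψ b hψ ⟨U, iU, iU', e, hU, y, hy⟩)

theorem exists_isOpen_not_realizes_of_isUniversal {σ : Expansions L L' N} {n : ℕ}
    {φ : (L.sum L').Formula (Fin n)} (hφ : BoundedFormula.IsUniversal φ) {b : Fin n → N}
    (hb : ¬ σ.Realizes φ b) :
    ∃ O : Set (Expansions L L' N), IsOpen O ∧ σ ∈ O ∧ ∀ τ ∈ O, ¬ τ.Realizes φ b := by
  obtain ⟨φ', hφ', Hn⟩ := exists_isExistential_not hφ
  obtain ⟨k, ψ, hψ, H⟩ := exists_qf_formula_of_isExistential hφ'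
  have H' : ∀ τ : Expansions L L' N, ¬ τ.Realizes φ b ↔
      ∃ y : Fin k → N, @Formula.Realize _ N τ.str0 _ ψ (Sum.elim b y) := fun τ =>
    (@Hn N τ.str0 b default).symm.trans (@H N τ.str0 b)
  obtain ⟨y, hy⟩ := (H' σ).1 hb
  exact ⟨_, isOpen_realize_of_isQF hψ (Sum.elim b y), hy, fun τ hτ => (H' τ).2 ⟨y, hτ⟩⟩

end Topology

section Types

/-- If a tuple realizes the universal and existential part of a complete type, then that part
is exactly its 1-diagram. -/
theorem restr1_eq_diag1 {U : Type} [(L.sum L').Structure U] {n : ℕ} {u : Fin n → U}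
    {σ : Expansions L L' N} {b : Fin n → N}
    (h : ∀ φ ∈ restr1 {φ : (L.sum L').Formula (Fin n) | φ.Realize u}, σ.Realizes φ b) :
    restr1 {φ : (L.sum L').Formula (Fin n) | φ.Realize u} = diag1 σ b := by
  ext φ
  refine ⟨fun hφ => ⟨h φ hφ, hφ.2⟩, fun hφ => ⟨?_, hφ.2⟩⟩
  by_contra hn
  rcases hφ.2 with hu | he
  · obtain ⟨ψ, hψ, H⟩ := exists_isExistential_not hu
    exact (@H N σ.str0 b default).1 (h ψ ⟨(H U u default).2 hn, Or.inr hψ⟩) hφ.1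
  · obtain ⟨ψ, hψ, H⟩ := exists_isUniversal_not he
    exact (@H N σ.str0 b default).1 (h ψ ⟨(H U u default).2 hn, Or.inl hψ⟩) hφ.1

theorem diag1_conjExp (g : N ≃[L] N) (τ : Expansions L L' N) {n : ℕ} (a : Fin n → N) :
    diag1 (conjExp g τ) (g ∘ a) = diag1 τ a := by
  ext φ
  exact and_congr_left fun _ => realize_conjExp g τ φ a

/-- Tuples of `N` with the same `L`-type are conjugate. -/
theorem exists_equiv_comp_eq [Countable N] (hsat : IsSaturated L N) {α : Type} [Finite α]
    {v w : α → N} (h : ∀ φ : L.Formula α, φ.Realize v → φ.Realize w) :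
    ∃ g : N ≃[L] N, g ∘ v = w := by
  obtain ⟨g, hg⟩ := exists_equiv_of_isElementaryRel hsat
    (Set.finite_range fun i => (v i, w i))
    (isElementaryRel_range fun φ => ⟨h φ, fun hw => by
      by_contra hn
      exact h φ.not hn hw⟩)
  exact ⟨g, funext fun i => hg _ (Set.mem_range_self i)⟩

/-- If all expansions in `Y` satisfying `θ(c)` have the same 1-diagram at `b`, then this
1-diagram is an isolated point of `S_x^Y`. -/
theorem isOpen_singleton_of_forall_diag1_eq [Countable N] (hsat : IsSaturated L N)
    {T₀ : (L.sum L').Theory} {n m : ℕ} {b : Fin n → N} {c : Fin m → N}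
    {θ : (L.sum L').Formula (Fin m)} (hθ : θ.IsQF) {σ : Expansions L L' N}
    (hσ : σ ∈ YSet L L' N T₀) (hσθ : σ.Realizes θ c) {d : Set ((L.sum L').Formula (Fin n))}
    (h : ∀ τ ∈ YSet L L' N T₀, τ.Realizes θ c → d = diag1 τ b) :
    @IsOpen _ (STop L L' N T₀ n) {q : ↥(SSet L L' N T₀ n) | ↑q = d} := by
  let π : EQF L L' n := ⟨m, {χ | χ.Realize (Sum.elim b c)}, θ.relabel Sum.inr, hθ.relabel _⟩
  have hπ : ∀ (τ : Expansions L L' N) (a : Fin n → N) (e : Fin m → N),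
      @Formula.Realize _ N τ.str0 _ (θ.relabel Sum.inr) (Sum.elim a e) ↔ τ.Realizes θ e := by
    intro τ a e
    let := τ.str0
    exact Formula.realize_relabel
  refine TopologicalSpace.isOpen_generateFrom_of_mem ⟨π, ?_⟩
  refine Set.ext fun q => ?_
  constructor
  · rintro ⟨⟨q, hq⟩, rfl, rfl⟩
    exact ⟨σ, hσ, b, h σ hσ hσθ, c, fun χ hχ => hχ, (hπ σ b c).2 hσθ⟩
  · rintro ⟨τ, hτ, a, rfl, e, he, hτθ⟩
    obtain ⟨g, hg⟩ := exists_equiv_comp_eq (v := Sum.elim b c) (w := Sum.elim a e) hsat he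
    have hga : g.symm ∘ a = b := funext fun i => by
      have := congrFun hg (.inl i)
      exact (congrArg g.symm this).symm.trans (g.symm_apply_apply _)
    have hge : g.symm ∘ e = c := funext fun i => by
      have := congrFun hg (.inr i)
      exact (congrArg g.symm this).symm.trans (g.symm_apply_apply _)
    have h1 : (conjExp g.symm τ).Realizes θ c := by
      rw [← hge]
      exact (realize_conjExp g.symm τ θ e).2 ((hπ τ a e).1 hτθ)
    have h2 := h _ (conjExp_mem_YSet hτ) h1
    rw [← hga, diag1_conjExp] at h2
    exact ⟨⟨_, τ, hτ, a, rfl⟩, h2.symm, rfl⟩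

end Types

/-- Suppose all e.c. models of `T₀` have the same existential theory.
If `p(x)` is a complete parameter-free `L₀`-type which is not e-isolated and `b` is a
finite tuple in `N`, then the set `X_b` of expansions `σ ∈ Y` in which `b` does not
realize `p↾1(x)` is open and dense in `Y`. -/
theorem statement13
    (T : L.Theory) (T₀ : (L.sum L').Theory)
    [Countable N] (hNT : N ⊨ T) (hTc : T.IsComplete) (hqe : HasQE L T)
    (hsmall : IsSmall L T) (hsat : IsSaturated L N)
    [Finite (Σ i, L'.Functions i)] [Finite (Σ i, L'.Relations i)]
    (hTT₀ : (LHom.sumInl : L →ᴸ L.sum L').onTheory T ⊆ T₀)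
    (huniv : UniversalTheoryModulo L L' T T₀)
    (hsame : SameExistentialTheory L L' T₀)
    (n : ℕ) (p : Set ((L.sum L').Formula (Fin n)))
    -- `p` is a complete parameter-free type (the type of a tuple in a model of `T₀`):
    (hp : ∃ (U : Type) (iU : L.Structure U) (iU' : L'.Structure U),
      letI := iU; letI := iU';
      (U ⊨ T₀) ∧ ∃ u : Fin n → U, p = {φ : (L.sum L').Formula (Fin n) | φ.Realize u})
    -- `p` is not e-isolated (its 1-part is not an isolated point of `S_x^Y`):
    (hiso : ¬ (restr1 p ∈ SSet L L' N T₀ n ∧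
      @IsOpen _ (STop L L' N T₀ n)
        {q : ↥(SSet L L' N T₀ n) | ↑q = restr1 p}))
    (b : Fin n → N) :
    IsOpen {σ : ↥(YSet L L' N T₀) |
        ¬ ∀ φ ∈ restr1 p, (↑σ : Expansions L L' N).Realizes φ b} ∧
    Dense {σ : ↥(YSet L L' N T₀) |
        ¬ ∀ φ ∈ restr1 p, (↑σ : Expansions L L' N).Realizes φ b} := by
  obtain ⟨U, iU, iU', -, u, rfl⟩ := hp
  constructor
  · rw [isOpen_iff_forall_mem_open]
    rintro ⟨σ, hσ⟩ hσb
    simp only [Set.mem_ofPred_eq, not_forall] at hσb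
    obtain ⟨φ, hφ, hb⟩ := hσb
    obtain ⟨O, hO, hσO, H⟩ : ∃ O : Set (Expansions L L' N), IsOpen O ∧ σ ∈ O ∧
        ∀ τ ∈ O, τ.ModelsTh T₀ → ¬ τ.Realizes φ b := by
      rcases hφ.2 with hu | he
      · obtain ⟨O, hO, hσO, H⟩ := exists_isOpen_not_realizes_of_isUniversal hu hb
        exact ⟨O, hO, hσO, fun τ hτ _ => H τ hτ⟩
      · exact exists_isOpen_not_realizes hσ.2.2 he hb
    exact ⟨Subtype.val ⁻¹' O, fun τ hτ h => H τ hτ τ.2.1 (h φ hφ),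
      hO.preimage continuous_subtype_val, hσO⟩
  · rw [dense_iff_inter_open]
    rintro V hV ⟨⟨σ, hσ⟩, hσV⟩
    obtain ⟨O, hO, rfl⟩ := isOpen_induced_iff.1 hV
    obtain ⟨m, θ, c, hθ, hσθ, H⟩ := exists_qf_of_isOpen hO hσV
    by_contra hne
    have key : ∀ τ ∈ YSet L L' N T₀, τ.Realizes θ c →
        restr1 {φ : (L.sum L').Formula (Fin n) | φ.Realize u} = diag1 τ b := by
      intro τ hτ hτθ
      by_contra hd
      exact hne ⟨⟨τ, hτ⟩, H τ hτθ, fun h => hd (restr1_eq_diag1 h)⟩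
    exact hiso ⟨⟨σ, hσ, b, key σ hσ hσθ⟩,
      isOpen_singleton_of_forall_diag1_eq hsat hθ hσ hσθ key⟩

end GenExp
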